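/- (Semi-discrete analogue of the Newton–Leibniz axiom.) Let a = x₁ < x₂ < ⋯ < xₙ = b be real numbers and let f : ℝ → ℝ be continuous on [a,b]. Assume that at every point x of each open interval (xᵢ, xᵢ₊₁) (for 1 ≤ i ≤ n−1), f is signposted detachable, i.e., both one-sided detachments exist and f₊^;(x) = −f₋^;(x) ≠ 0; assume also that f₊^;(xᵢ) exists for 1 ≤ i ≤ n−1 and f₋^;(xᵢ) exists for 2 ≤ i ≤ n. Let τ : ℝ → ℝ be any function satisfying τ(x) = sgn(f₊^;(x) − f₋^;(x)) for all x in the open intervals (xᵢ, xᵢ₊₁). Then ∫_{a}^{b} τ(x) dx = −[ Σ_{i=1}^{n−1} f₊^;(xᵢ)·xᵢ + Σ_{i=2}^{n} f₋^;(xᵢ)·xᵢ ]. -/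

import Mathlib

/-- `HasRightDetachment f x d` means the right detachment `f₊^;(x)` exists and
equals `d`, i.e. `sgn (f (x + h) - f x) → d` as `h → 0⁺`. -/
def HasRightDetachment (f : ℝ → ℝ) (x d : ℝ) : Prop :=
  Filter.Tendsto (fun h : ℝ => Real.sign (f (x + h) - f x))
    (nhdsWithin 0 (Set.Ioi 0)) (nhds d)

/-- `HasLeftDetachment f x d` means the left detachment `f₋^;(x)` exists and
equals `d`, i.e. `sgn (f (x + h) - f x) → d` as `h → 0⁻`. -/
def HasLeftDetachment (f : ℝ → ℝ) (x d : ℝ) : Prop :=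
  Filter.Tendsto (fun h : ℝ => Real.sign (f (x + h) - f x))
    (nhdsWithin 0 (Set.Iio 0)) (nhds d)

/-- `f` is tendable at `x` if both one-sided detachments exist. -/
def TendableAt (f : ℝ → ℝ) (x : ℝ) : Prop :=
  (∃ dp, HasRightDetachment f x dp) ∧ (∃ dm, HasLeftDetachment f x dm)

/-- `HasTendency f x t` means both one-sided detachments of `f` at `x` exist and
the tendency `τ_f(x) = sgn (f₊^;(x) - f₋^;(x))` equals `t`.  (Since limits in ℝ
are unique, this determines `t` uniquely whenever `f` is tendable at `x`.) -/
def HasTendency (f : ℝ → ℝ) (x t : ℝ) : Prop :=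
  ∃ dp dm, HasRightDetachment f x dp ∧ HasLeftDetachment f x dm ∧
    Real.sign (dp - dm) = t

open Set Filter Topology in
/-- A point with opposite nonzero one-sided detachments is not a local minimum. -/
theorem not_isLocalMin_of_detachment {f : ℝ → ℝ} {t d : ℝ} (hd : d ≠ 0)
    (hr : HasRightDetachment f t d) (hl : HasLeftDetachment f t (-d)) : ¬ IsLocalMin f t := by
  intro hmin
  have hshift : Tendsto (fun h : ℝ => t + h) (𝓝 0) (𝓝 t) := by
    have hc : Continuous fun h : ℝ => t + h := by fun_prop
    simpa using hc.tendsto 0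
  have hev : ∀ᶠ h in 𝓝 (0 : ℝ), 0 ≤ Real.sign (f (t + h) - f t) :=
    (hshift.eventually hmin).mono fun h hh => by
      rcases (sub_nonneg.2 hh).eq_or_lt with h₀ | h₀
      · rw [← h₀, Real.sign_zero]
      · rw [Real.sign_of_pos h₀]
        exact zero_le_one
  have h₁ : 0 ≤ d := ge_of_tendsto hr (hev.filter_mono nhdsWithin_le_nhds)
  have h₂ : 0 ≤ -d := ge_of_tendsto hl (hev.filter_mono nhdsWithin_le_nhds)
  exact hd (by linarith)

theorem HasRightDetachment.neg {f : ℝ → ℝ} {t d : ℝ} (h : HasRightDetachment f t d) :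
    HasRightDetachment (-f) t (-d) := by
  refine (Filter.Tendsto.neg h).congr fun s => ?_
  rw [← Real.sign_neg, Pi.neg_apply, Pi.neg_apply]
  congr 1
  ring

theorem HasLeftDetachment.neg {f : ℝ → ℝ} {t d : ℝ} (h : HasLeftDetachment f t d) :
    HasLeftDetachment (-f) t (-d) := by
  refine (Filter.Tendsto.neg h).congr fun s => ?_
  rw [← Real.sign_neg, Pi.neg_apply, Pi.neg_apply]
  congr 1
  ring

/-- A point with opposite nonzero one-sided detachments is not a local extremum. -/
theorem not_isLocalExtr_of_detachment {f : ℝ → ℝ} {t d : ℝ} (hd : d ≠ 0)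
    (hr : HasRightDetachment f t d) (hl : HasLeftDetachment f t (-d)) : ¬ IsLocalExtr f t := by
  rintro (h | h)
  · exact not_isLocalMin_of_detachment hd hr hl h
  · exact not_isLocalMin_of_detachment (neg_ne_zero.2 hd) hr.neg hl.neg h.neg

open Set in
/-- A continuous function that is signposted detachable inside an interval is strictly monotone
on the closed interval; the common sign of its increments is `e`. -/
theorem exists_sign_sub_eq_of_signposted {f : ℝ → ℝ} {u v : ℝ} (huv : u < v)
    (hcont : ContinuousOn f (Icc u v))
    (hs : ∀ t ∈ Ioo u v, ∃ d : ℝ, d ≠ 0 ∧ HasRightDetachment f t d ∧ HasLeftDetachment f t (-d)) :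
    ∃ e : ℝ, (e = 1 ∨ e = -1) ∧
      ∀ s ∈ Icc u v, ∀ t ∈ Icc u v, s < t → Real.sign (f t - f s) = e := by
  have hne : ∀ s ∈ Icc u v, ∀ t ∈ Icc u v, s < t → f s ≠ f t := by
    intro s hs' t ht hst heq
    obtain ⟨c, hc, hext⟩ :=
      exists_isLocalExtr_Ioo hst (hcont.mono (Icc_subset_Icc hs'.1 ht.2)) heq
    obtain ⟨d, hd, hr, hl⟩ := hs c ⟨hs'.1.trans_lt hc.1, hc.2.trans_le ht.2⟩
    exact not_isLocalExtr_of_detachment hd hr hl hext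
  have hinj : InjOn f (Icc u v) := by
    intro s hs' t ht heq
    rcases lt_trichotomy s t with h | h | h
    · exact absurd heq (hne s hs' t ht h)
    · exact h
    · exact absurd heq.symm (hne t ht s hs' h)
  rcases hcont.strictMonoOn_of_injOn_Icc' huv.le hinj with h | h
  · exact ⟨1, Or.inl rfl, fun s hs' t ht hst =>
      Real.sign_of_pos (sub_pos.2 (h hs' ht hst))⟩
  · exact ⟨-1, Or.inr rfl, fun s hs' t ht hst =>
      Real.sign_of_neg (sub_neg.2 (h hs' ht hst))⟩

open Set in
theorem hasRightDetachment_of_sign_sub_eq {f : ℝ → ℝ} {s v e : ℝ} (hsv : s < v)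
    (h : ∀ t ∈ Ioo s v, Real.sign (f t - f s) = e) : HasRightDetachment f s e := by
  refine tendsto_const_nhds.congr' ?_
  filter_upwards [Ioo_mem_nhdsGT (sub_pos.2 hsv)] with k hk
  exact (h (s + k) ⟨by linarith [hk.1], by linarith [hk.2]⟩).symm

open Set in
theorem hasLeftDetachment_of_sign_sub_eq {f : ℝ → ℝ} {u s e : ℝ} (hus : u < s)
    (h : ∀ t ∈ Ioo u s, Real.sign (f t - f s) = e) : HasLeftDetachment f s e := by
  refine tendsto_const_nhds.congr' ?_
  filter_upwards [Ioo_mem_nhdsLT (sub_neg.2 hus)] with k hk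
  exact (h (s + k) ⟨by linarith [hk.1], by linarith [hk.2]⟩).symm

open Set in
/-- On an interval where `f` is signposted detachable, the tendency is constant, and equals the
right detachment at the left endpoint and minus the left detachment at the right endpoint. -/
theorem exists_tendency_eq_of_signposted {f τ : ℝ → ℝ} {u v : ℝ} (huv : u < v)
    (hcont : ContinuousOn f (Icc u v))
    (hs : ∀ t ∈ Ioo u v, ∃ d : ℝ, d ≠ 0 ∧ HasRightDetachment f t d ∧ HasLeftDetachment f t (-d))
    (hτ : ∀ t ∈ Ioo u v, ∀ p m : ℝ, HasRightDetachment f t p → HasLeftDetachment f t m →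
      τ t = Real.sign (p - m)) :
    ∃ e : ℝ, HasRightDetachment f u e ∧ HasLeftDetachment f v (-e) ∧ ∀ t ∈ Ioo u v, τ t = e := by
  obtain ⟨e, he, hsign⟩ := exists_sign_sub_eq_of_signposted huv hcont hs
  have hright : ∀ s ∈ Ico u v, HasRightDetachment f s e := fun s hs' =>
    hasRightDetachment_of_sign_sub_eq hs'.2 fun t ht =>
      hsign s ⟨hs'.1, hs'.2.le⟩ t ⟨hs'.1.trans ht.1.le, ht.2.le⟩ ht.1
  have hleft : ∀ s ∈ Ioc u v, HasLeftDetachment f s (-e) := fun s hs' =>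
    hasLeftDetachment_of_sign_sub_eq hs'.1 fun t ht => by
      rw [← neg_sub, Real.sign_neg,
        hsign t ⟨ht.1.le, ht.2.le.trans hs'.2⟩ s ⟨hs'.1.le, hs'.2⟩ ht.2]
  refine ⟨e, hright u ⟨le_rfl, huv⟩, hleft v ⟨huv, le_rfl⟩, fun t ht => ?_⟩
  rw [hτ t ht e (-e) (hright t ⟨ht.1.le, ht.2⟩) (hleft t ⟨ht.1, ht.2.le⟩)]
  rcases he with rfl | rfl
  · exact Real.sign_of_pos (by norm_num)
  · exact Real.sign_of_neg (by norm_num)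

open Set MeasureTheory in
/-- A function constant on the open interval is integrable, with the expected integral. -/
theorem intervalIntegrable_and_integral_eq_of_eqOn_Ioo {τ : ℝ → ℝ} {u v e : ℝ} (huv : u ≤ v)
    (h : ∀ t ∈ Ioo u v, τ t = e) :
    IntervalIntegrable τ volume u v ∧ ∫ t in u..v, τ t = (v - u) * e := by
  have hae : (fun _ : ℝ => e) =ᵐ[volume.restrict (uIoc u v)] τ := by
    rw [uIoc_of_le huv, ← Measure.restrict_congr_set Ioo_ae_eq_Ioc]
    exact (ae_restrict_mem measurableSet_Ioo).mono fun t ht => (h t ht).symm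
  refine ⟨intervalIntegrable_const.congr_ae hae, ?_⟩
  rw [← intervalIntegral.integral_congr_ae_restrict hae, intervalIntegral.integral_const,
    smul_eq_mul]

open intervalIntegral in
/-- Semi-discrete analogue of the Newton–Leibniz axiom: with partition points
`a = x 1 < x 2 < ⋯ < x n = b`, `f` continuous on `[a, b]` and signposted
detachable on each open subinterval (`f₊^; = -f₋^; ≠ 0` there), and with `τ`
agreeing with the tendency `sgn (f₊^; - f₋^;)` on the open subintervals,
`∫_a^b τ = -[Σ_{i=1}^{n-1} f₊^;(xᵢ)·xᵢ + Σ_{i=2}^{n} f₋^;(xᵢ)·xᵢ]`. -/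
theorem newton_leibniz_analogue (n : ℕ) (hn : 2 ≤ n) (x : ℕ → ℝ)
    (hx : ∀ i : ℕ, 1 ≤ i → i < n → x i < x (i + 1))
    (f : ℝ → ℝ) (hcont : ContinuousOn f (Set.Icc (x 1) (x n)))
    (hsignposted : ∀ i : ℕ, 1 ≤ i → i < n → ∀ t ∈ Set.Ioo (x i) (x (i + 1)),
      ∃ d : ℝ, d ≠ 0 ∧ HasRightDetachment f t d ∧ HasLeftDetachment f t (-d))
    (dp dm : ℕ → ℝ)
    (hdp : ∀ i : ℕ, 1 ≤ i → i ≤ n - 1 → HasRightDetachment f (x i) (dp i))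
    (hdm : ∀ i : ℕ, 2 ≤ i → i ≤ n → HasLeftDetachment f (x i) (dm i))
    (τ : ℝ → ℝ)
    (hτ : ∀ i : ℕ, 1 ≤ i → i < n → ∀ t ∈ Set.Ioo (x i) (x (i + 1)),
      ∀ p m : ℝ, HasRightDetachment f t p → HasLeftDetachment f t m →
        τ t = Real.sign (p - m)) :
    (∫ t in (x 1)..(x n), τ t) =
      -((∑ i ∈ Finset.Icc 1 (n - 1), dp i * x i) +
        ∑ i ∈ Finset.Icc 2 n, dm i * x i) := by
  have hle : ∀ i j, 1 ≤ i → i ≤ j → j ≤ n → x i ≤ x j := by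
    intro i j hi hij
    induction j, hij using Nat.le_induction with
    | base => exact fun _ => le_rfl
    | succ j hij ih => exact fun hj => (ih (by omega)).trans (hx j (by omega) (by omega)).le
  have hpiece : ∀ i, 1 ≤ i → i < n → IntervalIntegrable τ MeasureTheory.volume (x i) (x (i + 1)) ∧
      ∫ t in (x i)..(x (i + 1)), τ t = -(dp i * x i + dm (i + 1) * x (i + 1)) := by
    intro i hi hin
    have hlt := hx i hi hin
    obtain ⟨e, hr, hl, he⟩ := exists_tendency_eq_of_signposted hlt
      (hcont.mono (Set.Icc_subset_Icc (hle 1 i le_rfl hi hin.le)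
        (hle (i + 1) n (by omega) hin le_rfl))) (hsignposted i hi hin) (hτ i hi hin)
    obtain ⟨hint, heq⟩ := intervalIntegrable_and_integral_eq_of_eqOn_Ioo hlt.le he
    have hp : dp i = e := tendsto_nhds_unique (hdp i hi (by omega)) hr
    have hm : dm (i + 1) = -e := tendsto_nhds_unique (hdm (i + 1) (by omega) hin) hl
    refine ⟨hint, ?_⟩
    rw [heq, hp, hm]
    ring
  rw [← sum_integral_adjacent_intervals_Ico (a := x) (by omega : 1 ≤ n)
    fun i hi => (hpiece i hi.1 hi.2).1]
  have hleft : Finset.Icc 1 (n - 1) = Finset.Ico 1 n := by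
    ext i
    simp only [Finset.mem_Icc, Finset.mem_Ico]
    omega
  have hright : Finset.Icc 2 n = Finset.Ico (1 + 1) (n + 1) := by
    ext i
    simp only [Finset.mem_Icc, Finset.mem_Ico]
    omega
  rw [hleft, hright, ← Finset.sum_Ico_add' (fun i => dm i * x i), ← Finset.sum_add_distrib,
    ← Finset.sum_neg_distrib]
  refine Finset.sum_congr rfl fun i hi => ?_
  rw [Finset.mem_Ico] at hi
  exact (hpiece i hi.1 hi.2).2
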